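/- Let f be a smooth 2π-periodic vector field on ℝⁿ and let P = (δ_{kl} + R_k R_l) be the Leray projector, where R_i is the i-th Riesz transform (acting on each Fourier mode ξ ≠ 0 as multiplication by -iξ_i/|ξ|, and as 0 on the zero mode). Then for every j ≥ 1 there is a constant C_j > 0, independent of t and f, with |D^α e^{tΔ} (P f)|_∞ ≤ C_j t^{-j/2} |f|_∞ for all t > 0 and all multiindices α with |α| = j. -/

import Mathlib

open scoped BigOperators

open MeasureTheory in
/-- `m` is a Fourier multiplier with sup-norm operator bound `B`. -/
def HLMult {n : ℕ} (m : (Fin n → ℤ) → ℂ) (B : ℝ) : Prop :=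
  (∀ ξ, ‖m ξ‖ ≤ B) ∧ ∀ a : (Fin n → ℤ) → ℂ, Summable (fun ξ => ‖a ξ‖) → ∀ S : ℝ,
    (∀ y : Fin n → ℝ, ‖∑' ξ : Fin n → ℤ,
      a ξ * Complex.exp (Complex.I * Complex.ofReal (∑ i, (ξ i : ℝ) * y i))‖ ≤ S) →
    ∀ x : Fin n → ℝ, ‖∑' ξ : Fin n → ℤ,
      m ξ * a ξ * Complex.exp (Complex.I * Complex.ofReal (∑ i, (ξ i : ℝ) * x i))‖ ≤ B * S

lemma hl_norm_e (r : ℝ) : ‖Complex.exp (Complex.I * Complex.ofReal r)‖ = 1 := by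
  rw [mul_comm]; exact Complex.norm_exp_ofReal_mul_I r

lemma HLMult.nonneg {n : ℕ} {m : (Fin n → ℤ) → ℂ} {B : ℝ} (h : HLMult m B) : 0 ≤ B :=
  (norm_nonneg _).trans (h.1 0)

lemma HLMult.summable {n : ℕ} {m : (Fin n → ℤ) → ℂ} {B : ℝ} (h : HLMult m B)
    {a : (Fin n → ℤ) → ℂ} (ha : Summable (fun ξ => ‖a ξ‖)) :
    Summable (fun ξ => ‖m ξ * a ξ‖) := by
  refine Summable.of_nonneg_of_le (fun _ => norm_nonneg _) (fun ξ => ?_) (ha.mul_left B)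
  rw [norm_mul]
  exact mul_le_mul_of_nonneg_right (h.1 ξ) (norm_nonneg _)

lemma hl_summable_e {n : ℕ} {a : (Fin n → ℤ) → ℂ} (ha : Summable (fun ξ => ‖a ξ‖))
    (x : Fin n → ℝ) : Summable (fun ξ : Fin n → ℤ =>
      a ξ * Complex.exp (Complex.I * Complex.ofReal (∑ i, (ξ i : ℝ) * x i))) := by
  refine Summable.of_norm ?_
  simpa only [norm_mul, hl_norm_e, mul_one] using ha

lemma HLMult.one {n : ℕ} : HLMult (fun _ : Fin n → ℤ => (1 : ℂ)) 1 := by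
  refine ⟨by simp, fun a _ S hS x => ?_⟩
  simpa using hS x

lemma HLMult.mul {n : ℕ} {m₁ m₂ : (Fin n → ℤ) → ℂ} {B₁ B₂ : ℝ} (h₁ : HLMult m₁ B₁)
    (h₂ : HLMult m₂ B₂) : HLMult (fun ξ => m₁ ξ * m₂ ξ) (B₁ * B₂) := by
  refine ⟨fun ξ => ?_, fun a ha S hS x => ?_⟩
  · rw [norm_mul]
    exact mul_le_mul (h₁.1 ξ) (h₂.1 ξ) (norm_nonneg _) h₁.nonneg
  · have := h₁.2 (fun ξ => m₂ ξ * a ξ) (h₂.summable ha) (B₂ * S) (h₂.2 a ha S hS) x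
    simpa only [mul_assoc] using this

lemma HLMult.pow {n : ℕ} {m : (Fin n → ℤ) → ℂ} {B : ℝ} (h : HLMult m B) (p : ℕ) :
    HLMult (fun ξ => m ξ ^ p) (B ^ p) := by
  induction p with
  | zero => simpa using HLMult.one
  | succ p ih => simpa only [pow_succ] using ih.mul h

lemma HLMult.prod {n : ℕ} {ι : Type*} (s : Finset ι) {m : ι → (Fin n → ℤ) → ℂ} {B : ι → ℝ}
    (h : ∀ i, HLMult (m i) (B i)) : HLMult (fun ξ => ∏ i ∈ s, m i ξ) (∏ i ∈ s, B i) := by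
  classical
  induction s using Finset.induction_on with
  | empty => simpa using HLMult.one
  | insert i s hi ih => simpa only [Finset.prod_insert hi] using (h i).mul ih

lemma HLMult.mono {n : ℕ} {m : (Fin n → ℤ) → ℂ} {B B' : ℝ} (h : HLMult m B) (hB : B ≤ B') :
    HLMult m B' := by
  refine ⟨fun ξ => (h.1 ξ).trans hB, fun a ha S hS x => (h.2 a ha S hS x).trans ?_⟩
  exact mul_le_mul_of_nonneg_right hB ((norm_nonneg _).trans (hS 0))

lemma HLMult.add {n : ℕ} {m₁ m₂ : (Fin n → ℤ) → ℂ} {B₁ B₂ : ℝ} (h₁ : HLMult m₁ B₁)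
    (h₂ : HLMult m₂ B₂) : HLMult (fun ξ => m₁ ξ + m₂ ξ) (B₁ + B₂) := by
  refine ⟨fun ξ => (norm_add_le _ _).trans (add_le_add (h₁.1 ξ) (h₂.1 ξ)),
    fun a ha S hS x => ?_⟩
  simp only [add_mul]
  rw [(hl_summable_e (h₁.summable ha) x).tsum_add (hl_summable_e (h₂.summable ha) x)]
  exact (norm_add_le _ _).trans (add_le_add (h₁.2 a ha S hS x) (h₂.2 a ha S hS x))

lemma HLMult.const_mul {n : ℕ} {m : (Fin n → ℤ) → ℂ} {B : ℝ} (h : HLMult m B) (c : ℂ) :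
    HLMult (fun ξ => c * m ξ) (‖c‖ * B) := by
  refine ⟨fun ξ => ?_, fun a ha S hS x => ?_⟩
  · rw [norm_mul]
    exact mul_le_mul_of_nonneg_left (h.1 ξ) (norm_nonneg _)
  · simp only [mul_assoc c]
    rw [tsum_mul_left, norm_mul, mul_assoc]
    exact mul_le_mul_of_nonneg_left (h.2 a ha S hS x) (norm_nonneg _)

open MeasureTheory in
lemma HLMult.integral {n : ℕ} (μ : Measure ℝ) {m : ℝ → (Fin n → ℤ) → ℂ} {B : ℝ → ℝ}
    (hB : Integrable B μ) (hm : ∀ ξ, AEStronglyMeasurable (fun s => m s ξ) μ)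
    (h : ∀ᵐ s ∂μ, HLMult (m s) (B s)) :
    HLMult (fun ξ => ∫ s, m s ξ ∂μ) (∫ s, B s ∂μ) := by
  have hint : ∀ ξ, Integrable (fun s => m s ξ) μ := fun ξ =>
    hB.mono' (hm ξ) (h.mono fun s hs => hs.1 ξ)
  refine ⟨fun ξ => norm_integral_le_of_norm_le hB (h.mono fun s hs => hs.1 ξ),
    fun a ha S hS x => ?_⟩
  simp only [← integral_mul_const]
  rw [integral_tsum_of_summable_integral_norm]
  · refine norm_integral_le_of_norm_le (hB.mul_const S) (h.mono fun s hs => hs.2 a ha S hS x)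
  · intro ξ
    exact ((hint ξ).mul_const _).mul_const _
  · refine Summable.of_nonneg_of_le (fun ξ => integral_nonneg fun _ => norm_nonneg _)
      (fun ξ => ?_) (ha.mul_left (∫ s, B s ∂μ))
    simp only [norm_mul, hl_norm_e, mul_one]
    rw [integral_mul_const]
    refine mul_le_mul_of_nonneg_right ?_ (norm_nonneg _)
    exact integral_mono_ae (hint ξ).norm hB (h.mono fun s hs => hs.1 ξ)

/-- Translations. -/
lemma HLMult.shift {n : ℕ} (i : Fin n) (r : ℝ) :
    HLMult (fun ξ : Fin n → ℤ => Complex.exp (Complex.I * Complex.ofReal ((ξ i : ℝ) * r))) 1 := by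
  refine ⟨fun ξ => (hl_norm_e _).le, fun a ha S hS x => ?_⟩
  rw [one_mul]
  convert hS (x + Pi.single i r) using 4 with ξ
  rw [mul_comm (Complex.exp _) (a ξ), mul_assoc, ← Complex.exp_add, ← mul_add, ← Complex.ofReal_add]
  congr 4
  simp only [Pi.add_apply, mul_add, Finset.sum_add_distrib]
  rw [add_comm]
  congr 1
  simp [Pi.single_apply]

open MeasureTheory in
lemma HLMult.kernel {n : ℕ} (i : Fin n) (r : ℝ) (K : ℝ → ℂ) (hK : Integrable K) :
    HLMult (fun ξ : Fin n → ℤ => ∫ z : ℝ, K z *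
      Complex.exp (Complex.I * Complex.ofReal ((ξ i : ℝ) * r * z))) (∫ z, ‖K z‖) := by
  refine HLMult.integral volume hK.norm (fun ξ => ?_) (Filter.Eventually.of_forall fun z => ?_)
  · refine hK.aestronglyMeasurable.mul (Continuous.aestronglyMeasurable ?_)
    fun_prop
  · have := (HLMult.shift i (r * z)).const_mul (K z)
    simpa only [mul_one, mul_assoc] using this

open MeasureTheory in
lemma hl_gauss : ∃ K : ℝ → ℂ, Integrable K ∧ ∀ η : ℝ,
    ∫ z : ℝ, K z * Complex.exp (Complex.I * Complex.ofReal (η * z)) =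
      Complex.exp (-(η : ℂ) ^ 2) := by
  have hb : (0 : ℝ) < ((1 / 4 : ℂ)).re := by norm_num
  have hc : ((Real.pi : ℂ) / (1 / 4 : ℂ)) ^ (1 / 2 : ℂ) ≠ 0 := by
    rw [Ne, Complex.cpow_eq_zero_iff]
    simp [Real.pi_ne_zero]
  refine ⟨fun z => (((Real.pi : ℂ) / (1 / 4 : ℂ)) ^ (1 / 2 : ℂ))⁻¹ *
    Complex.exp (-(1 / 4 : ℂ) * (z : ℂ) ^ 2), (integrable_cexp_neg_mul_sq hb).const_mul _, ?_⟩
  intro η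
  have := fourierIntegral_gaussian hb (η : ℂ)
  have h2 : ∀ z : ℝ, (((Real.pi : ℂ) / (1 / 4 : ℂ)) ^ (1 / 2 : ℂ))⁻¹ *
      Complex.exp (-(1 / 4 : ℂ) * (z : ℂ) ^ 2) *
      Complex.exp (Complex.I * Complex.ofReal (η * z)) =
      (((Real.pi : ℂ) / (1 / 4 : ℂ)) ^ (1 / 2 : ℂ))⁻¹ *
      (Complex.exp (Complex.I * η * z) * Complex.exp (-(1 / 4 : ℂ) * (z : ℂ) ^ 2)) := by
    intro z
    push_cast
    rw [← mul_assoc Complex.I]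
    ring
  simp only [h2]
  rw [integral_const_mul]
  rw [this, ← mul_assoc, inv_mul_cancel₀ hc, one_mul]
  congr 1
  ring

open MeasureTheory in
lemma hl_gauss_deriv : ∃ K : ℝ → ℂ, Integrable K ∧ ∀ η : ℝ,
    ∫ z : ℝ, K z * Complex.exp (Complex.I * Complex.ofReal (η * z)) =
      Complex.I * η * Complex.exp (-(η : ℂ) ^ 2) := by
  have hb : (0 : ℝ) < ((1 / 4 : ℂ)).re := by norm_num
  set c := ((Real.pi : ℂ) / (1 / 4 : ℂ)) ^ (1 / 2 : ℂ) with hcdef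
  have hc : c ≠ 0 := by
    rw [hcdef, Ne, Complex.cpow_eq_zero_iff]
    simp [Real.pi_ne_zero]
  have hi0 : Integrable (fun z : ℝ => Complex.exp (-(1 / 4 : ℂ) * (z : ℂ) ^ 2)) :=
    integrable_cexp_neg_mul_sq hb
  have hi1 : Integrable (fun z : ℝ => (z : ℂ) * Complex.exp (-(1 / 4 : ℂ) * (z : ℂ) ^ 2)) :=
    integrable_mul_cexp_neg_mul_sq hb
  refine ⟨fun z => (c⁻¹ * (1 / 2)) * ((z : ℂ) *
    Complex.exp (-(1 / 4 : ℂ) * (z : ℂ) ^ 2)), hi1.const_mul _, ?_⟩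
  intro η
  have hne : ∀ {g : ℝ → ℂ}, Integrable g →
      Integrable (fun z : ℝ => Complex.exp (Complex.I * η * z) * g z) := by
    intro g hg
    refine hg.bdd_mul (c := 1) (Continuous.aestronglyMeasurable (by fun_prop))
      (Filter.Eventually.of_forall fun z => ?_)
    have := hl_norm_e (η * z)
    push_cast at this
    rw [← mul_assoc] at this
    exact this.le
  have hu : ∀ z : ℝ, HasDerivAt (fun z : ℝ => Complex.exp (Complex.I * η * z))
      (Complex.I * η * Complex.exp (Complex.I * η * z)) z := by
    intro z
    have h1 : HasDerivAt (fun w : ℂ => Complex.exp (Complex.I * η * w))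
        (Complex.exp (Complex.I * η * z) * (Complex.I * η * 1)) (z : ℂ) :=
      ((hasDerivAt_id (z : ℂ)).const_mul (Complex.I * (η : ℂ))).cexp
    convert h1.comp_ofReal using 1
    ring
  have hv : ∀ z : ℝ, HasDerivAt (fun z : ℝ => Complex.exp (-(1 / 4 : ℂ) * (z : ℂ) ^ 2))
      (-(1 / 2) * ((z : ℂ) * Complex.exp (-(1 / 4 : ℂ) * (z : ℂ) ^ 2))) z := by
    intro z
    have h1 := ((hasDerivAt_pow 2 (z : ℂ)).const_mul (-(1 / 4 : ℂ))).cexp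
    convert h1.comp_ofReal using 1
    push_cast
    ring
  have key := integral_mul_deriv_eq_deriv_mul_of_integrable (fun z _ => hu z) (fun z _ => hv z)
    (hne (hi1.const_mul _))
    (by simpa only [Pi.mul_def, mul_assoc] using ((hne hi0).const_mul (Complex.I * η)))
    (hne hi0)
  have h2 : ∀ z : ℝ, (c⁻¹ * (1 / 2)) * ((z : ℂ) * Complex.exp (-(1 / 4 : ℂ) * (z : ℂ) ^ 2)) *
      Complex.exp (Complex.I * Complex.ofReal (η * z)) =
      (-c⁻¹) * (Complex.exp (Complex.I * η * z) *
        (-(1 / 2) * ((z : ℂ) * Complex.exp (-(1 / 4 : ℂ) * (z : ℂ) ^ 2)))) := by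
    intro z
    push_cast
    rw [← mul_assoc Complex.I]
    ring
  simp only [h2]
  rw [integral_const_mul, key]
  simp only [mul_assoc (Complex.I * (η : ℂ))]
  have := fourierIntegral_gaussian hb (η : ℂ)
  simp only [mul_assoc] at this ⊢
  rw [integral_const_mul, integral_const_mul, this, ← hcdef]
  have h3 : -(η : ℂ) ^ 2 / (4 * (1 / 4)) = -(η : ℂ) ^ 2 := by ring
  rw [h3]
  field_simp

lemma hl_base : ∃ c₀ c₁ : ℝ, 0 ≤ c₀ ∧ 0 ≤ c₁ ∧ ∀ (n : ℕ) (i : Fin n) (s : ℝ), 0 < s →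
    HLMult (fun ξ : Fin n → ℤ => Complex.exp (-(s : ℂ) * (ξ i : ℂ) ^ 2)) c₀ ∧
    HLMult (fun ξ : Fin n → ℤ => Complex.I * (ξ i : ℂ) * Complex.exp (-(s : ℂ) * (ξ i : ℂ) ^ 2))
      (c₁ * (√s)⁻¹) := by
  obtain ⟨K, hK, hKe⟩ := hl_gauss
  obtain ⟨L, hL, hLe⟩ := hl_gauss_deriv
  refine ⟨∫ z, ‖K z‖, ∫ z, ‖L z‖, MeasureTheory.integral_nonneg fun _ => norm_nonneg _,
    MeasureTheory.integral_nonneg fun _ => norm_nonneg _, fun n i s hs => ?_⟩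
  have hsq : ((√s : ℝ) : ℂ) ^ 2 = (s : ℂ) := by
    rw [← Complex.ofReal_pow, Real.sq_sqrt hs.le]
  have hs0 : ((√s : ℝ) : ℂ) ≠ 0 := by
    exact_mod_cast (Real.sqrt_pos.2 hs).ne'
  have he : ∀ ξ : Fin n → ℤ, -(((ξ i : ℝ) * √s : ℝ) : ℂ) ^ 2 = -(s : ℂ) * (ξ i : ℂ) ^ 2 := by
    intro ξ
    push_cast
    rw [mul_pow, hsq]
    ring
  constructor
  · have := HLMult.kernel i (√s) K hK
    simpa only [hKe, he] using this
  · have := (HLMult.kernel i (√s) L hL).const_mul (((√s : ℝ) : ℂ)⁻¹)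
    simp only [hLe, he] at this
    rw [norm_inv, Complex.norm_real, Real.norm_of_nonneg (Real.sqrt_nonneg s), mul_comm] at this
    convert this using 2 with ξ
    push_cast
    field_simp

/-- Derivatives of the heat semigroup. -/
lemma hl_heat (n j : ℕ) : ∃ A : ℝ, 0 ≤ A ∧ ∀ s : ℝ, 0 < s → ∀ α : Fin n → ℕ, (∑ i, α i) = j →
    HLMult (fun ξ : Fin n → ℤ => (∏ i, (Complex.I * (ξ i : ℂ)) ^ α i) *
      Complex.exp (-(s : ℂ) * Complex.ofReal (∑ i, (ξ i : ℝ) ^ 2))) (A * s ^ (-(j : ℝ) / 2)) := by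
  obtain ⟨c₀, c₁, h0, h1, hb⟩ := hl_base
  refine ⟨c₀ ^ n * (c₁ * √(j + 1)) ^ j, by positivity, fun s hs α hα => ?_⟩
  have hj : (0 : ℝ) < j + 1 := by positivity
  have hle : ∀ i, α i ≤ j := fun i => hα ▸ Finset.single_le_sum (fun _ _ => Nat.zero_le _)
    (Finset.mem_univ i)
  have hpos : ∀ i, 0 < s * (j + 1 - α i) / (j + 1) := by
    intro i
    have : (α i : ℝ) ≤ j := by exact_mod_cast hle i
    have : (0 : ℝ) < j + 1 - α i := by linarith
    positivity
  have hp := HLMult.prod Finset.univ (fun i => ((hb n i _ (hpos i)).1).mul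
    (((hb n i (s / (j + 1)) (by positivity)).2).pow (α i)))
  convert hp using 1
  · funext ξ
    push_cast
    rw [Finset.mul_sum, Complex.exp_sum, ← Finset.prod_mul_distrib]
    refine Finset.prod_congr rfl fun i _ => ?_
    rw [mul_pow _ (Complex.exp _), ← Complex.exp_nat_mul, mul_left_comm, ← Complex.exp_add]
    congr 2
    have : (j : ℂ) + 1 ≠ 0 := by exact_mod_cast hj.ne'
    field_simp
    ring
  · rw [Finset.prod_mul_distrib, Finset.prod_pow_eq_pow_sum, hα, Finset.prod_const,
      Finset.card_univ, Fintype.card_fin, mul_assoc]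
    congr 1
    have : s ^ (-(j : ℝ) / 2) = ((√s)⁻¹) ^ j := by
      rw [Real.sqrt_eq_rpow, ← Real.rpow_neg hs.le, ← Real.rpow_natCast, ← Real.rpow_mul hs.le]
      congr 1
      ring
    rw [this, ← mul_pow]
    congr 1
    rw [Real.sqrt_div hs.le, inv_div]
    ring

open MeasureTheory in
lemma hl_riesz (n j : ℕ) (hj : 1 ≤ j) : ∃ A : ℝ, 0 ≤ A ∧ ∀ t : ℝ, 0 < t → ∀ α : Fin n → ℕ,
    (∑ i, α i) = j → ∀ k l : Fin n,
    HLMult (fun ξ : Fin n → ℤ => (∏ i, (Complex.I * (ξ i : ℂ)) ^ α i) *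
      Complex.exp (-(t : ℂ) * Complex.ofReal (∑ i, (ξ i : ℝ) ^ 2)) *
      (-((ξ k : ℂ) * (ξ l : ℂ) / Complex.ofReal (∑ i, (ξ i : ℝ) ^ 2))))
      (A * t ^ (-(j : ℝ) / 2)) := by
  obtain ⟨A, hA, h⟩ := hl_heat n (j + 2)
  have hj' : (0 : ℝ) < j := by exact_mod_cast hj
  refine ⟨A * (2 / j), by positivity, fun t ht α hα k l => ?_⟩
  set β : Fin n → ℕ := α + Pi.single k 1 + Pi.single l 1 with hβ
  have hβs : ∑ i, β i = j + 2 := by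
    simp [hβ, Finset.sum_add_distrib, hα]
  have hβp : ∀ ξ : Fin n → ℤ, (∏ i, (Complex.I * (ξ i : ℂ)) ^ β i) =
      (∏ i, (Complex.I * (ξ i : ℂ)) ^ α i) * (-((ξ k : ℂ) * (ξ l : ℂ))) := by
    intro ξ
    have hs : ∀ k : Fin n, ∏ i, (Complex.I * (ξ i : ℂ)) ^ ((Pi.single k 1 : Fin n → ℕ) i) =
        Complex.I * (ξ k : ℂ) := by
      intro k
      rw [Finset.prod_eq_single k]
      · simp
      · intro b _ hbk; simp [hbk]
      · simp
    simp only [hβ, Pi.add_apply, pow_add, Finset.prod_mul_distrib, hs]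
    linear_combination (∏ i, (Complex.I * (ξ i : ℂ)) ^ α i) * (ξ k : ℂ) * (ξ l : ℂ) * Complex.I_sq
  have hlt : (-((j + 2 : ℕ) : ℝ) / 2) < -1 := by push_cast; linarith
  have hI := HLMult.integral (volume.restrict (Set.Ioi t))
    ((integrableOn_Ioi_rpow_of_lt hlt ht).const_mul A)
    (m := fun s ξ => (∏ i, (Complex.I * (ξ i : ℂ)) ^ β i) *
      Complex.exp (-(s : ℂ) * Complex.ofReal (∑ i, (ξ i : ℝ) ^ 2)))
    (fun ξ => Continuous.aestronglyMeasurable (by fun_prop))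
    ((ae_restrict_mem measurableSet_Ioi).mono fun s hs => h s (ht.trans hs) β hβs)
  convert hI using 1
  · funext ξ
    rw [integral_const_mul, hβp]
    by_cases hξ : ξ k = 0
    · simp [hξ]
    have hq : 0 < ∑ i, (ξ i : ℝ) ^ 2 := by
      refine Finset.sum_pos' (fun i _ => sq_nonneg _) ⟨k, Finset.mem_univ k, ?_⟩
      have : (ξ k : ℝ) ≠ 0 := by exact_mod_cast hξ
      positivity
    generalize (∑ i, (ξ i : ℝ) ^ 2) = q at hq
    have hq' : (q : ℂ) ≠ 0 := by exact_mod_cast hq.ne'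
    have : ∫ s : ℝ in Set.Ioi t, Complex.exp (-(s : ℂ) * q) =
        Complex.exp (-(t : ℂ) * q) / q := by
      have := integral_exp_mul_complex_Ioi (a := -(q : ℂ)) (by simpa using hq) t
      simp only [neg_mul, mul_comm (q : ℂ)] at this
      simp only [neg_mul]
      rw [this, neg_div_neg_eq]
    rw [this]
    ring
  · rw [integral_const_mul, integral_Ioi_rpow_of_lt hlt ht, mul_assoc]
    congr 1
    have e : (-((j + 2 : ℕ) : ℝ) / 2) + 1 = -(j : ℝ) / 2 := by push_cast; ring
    rw [e]
    field_simp


/-- Smoothing estimate for the heat semigroup composed with the Leray projector on the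
torus: for every `j ≥ 1` there is `C_j > 0`, independent of `t` and `f`, such that for a
smooth `2π`-periodic vector field `f` with rapidly decaying Fourier coefficients
`a : ℤⁿ → ℂⁿ` (so `f(x) = Σ_ξ a(ξ) e^{iξ·x}`), every multiindex `α` with `|α| = j`, every
component `k`, and every `t > 0`,
`|D^α e^{tΔ}(P f)_k|_∞ ≤ C_j t^{-j/2} |f|_∞`, where on Fourier mode `ξ ≠ 0` the Leray
projector is the matrix `δ_{kl} - ξ_k ξ_l/|ξ|²` (identity on the zero mode). -/
theorem heat_leray_derivative_estimate (n j : ℕ) (hn : 3 ≤ n) (hj : 1 ≤ j) :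
    ∃ C > 0, ∀ a : (Fin n → ℤ) → Fin n → ℂ,
      (∀ m : ℕ, Summable (fun ξ : Fin n → ℤ => (1 + ∑ i, (ξ i : ℝ) ^ 2) ^ m * ‖a ξ‖)) →
      ∀ t : ℝ, 0 < t → ∀ α : Fin n → ℕ, (∑ i, α i) = j → ∀ k : Fin n, ∀ x : Fin n → ℝ,
        ‖∑' ξ : Fin n → ℤ,
            (∏ i, (Complex.I * (ξ i : ℂ)) ^ α i) *
              Complex.exp (-(t : ℂ) * Complex.ofReal (∑ i, (ξ i : ℝ) ^ 2)) *
              (∑ l, (if ξ = 0 then (if k = l then (1 : ℂ) else 0)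
                     else ((if k = l then (1 : ℂ) else 0) -
                        (ξ k : ℂ) * (ξ l : ℂ) / Complex.ofReal (∑ i, (ξ i : ℝ) ^ 2))) * a ξ l) *
              Complex.exp (Complex.I * Complex.ofReal (∑ i, (ξ i : ℝ) * x i))‖
          ≤ C * t ^ (-(j : ℝ) / 2) *
              ⨆ y : Fin n → ℝ, ‖fun l : Fin n =>
                ∑' ξ : Fin n → ℤ,
                  a ξ l * Complex.exp (Complex.I * Complex.ofReal (∑ i, (ξ i : ℝ) * y i))‖ := by
  obtain ⟨A, hA, hheat⟩ := hl_heat n j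
  obtain ⟨A', hA', hriesz⟩ := hl_riesz n j hj
  refine ⟨n * (A + A') + 1, by positivity, fun a ha t ht α hα k x => ?_⟩
  have ha0 : Summable (fun ξ => ‖a ξ‖) := by simpa using ha 0
  have hal : ∀ l, Summable (fun ξ => ‖a ξ l‖) := fun l =>
    Summable.of_nonneg_of_le (fun _ => norm_nonneg _) (fun ξ => norm_le_pi_norm (a ξ) l) ha0
  set F : (Fin n → ℝ) → Fin n → ℂ := fun y l => ∑' ξ : Fin n → ℤ,
    a ξ l * Complex.exp (Complex.I * Complex.ofReal (∑ i, (ξ i : ℝ) * y i)) with hF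
  have hbdd : BddAbove (Set.range fun y => ‖F y‖) := by
    refine ⟨∑' ξ, ‖a ξ‖, ?_⟩
    rintro _ ⟨y, rfl⟩
    refine (pi_norm_le_iff_of_nonneg (tsum_nonneg fun _ => norm_nonneg _)).2 fun l => ?_
    refine tsum_of_norm_bounded ha0.hasSum fun ξ => ?_
    rw [norm_mul, hl_norm_e, mul_one]
    exact norm_le_pi_norm (a ξ) l
  change _ ≤ _ * ⨆ y, ‖F y‖
  set S := ⨆ y, ‖F y‖ with hS
  have hFS : ∀ l y, ‖F y l‖ ≤ S := fun l y =>
    (norm_le_pi_norm (F y) l).trans (le_ciSup hbdd y)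
  have hS0 : 0 ≤ S := (norm_nonneg _).trans (hFS k 0)
  set T := t ^ (-(j : ℝ) / 2) with hT
  have hT0 : 0 ≤ T := Real.rpow_nonneg ht.le _
  set μ : Fin n → (Fin n → ℤ) → ℂ := fun l ξ =>
    (if k = l then (1 : ℂ) else 0) * ((∏ i, (Complex.I * (ξ i : ℂ)) ^ α i) *
      Complex.exp (-(t : ℂ) * Complex.ofReal (∑ i, (ξ i : ℝ) ^ 2))) +
    (∏ i, (Complex.I * (ξ i : ℂ)) ^ α i) *
      Complex.exp (-(t : ℂ) * Complex.ofReal (∑ i, (ξ i : ℝ) ^ 2)) *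
      (-((ξ k : ℂ) * (ξ l : ℂ) / Complex.ofReal (∑ i, (ξ i : ℝ) ^ 2))) with hμ
  have hM : ∀ l, HLMult (μ l) (A * T + A' * T) := by
    intro l
    refine HLMult.add (((hheat t ht α hα).const_mul _).mono ?_) (hriesz t ht α hα k l)
    have : ‖(if k = l then (1 : ℂ) else 0)‖ ≤ 1 := by split_ifs <;> simp
    exact mul_le_of_le_one_left (by positivity) this
  have hsum : ∀ ξ : Fin n → ℤ, (∏ i, (Complex.I * (ξ i : ℂ)) ^ α i) *
              Complex.exp (-(t : ℂ) * Complex.ofReal (∑ i, (ξ i : ℝ) ^ 2)) *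
              (∑ l, (if ξ = 0 then (if k = l then (1 : ℂ) else 0)
                     else ((if k = l then (1 : ℂ) else 0) -
                        (ξ k : ℂ) * (ξ l : ℂ) / Complex.ofReal (∑ i, (ξ i : ℝ) ^ 2))) * a ξ l) *
              Complex.exp (Complex.I * Complex.ofReal (∑ i, (ξ i : ℝ) * x i)) =
      ∑ l, μ l ξ * a ξ l * Complex.exp (Complex.I * Complex.ofReal (∑ i, (ξ i : ℝ) * x i)) := by
    intro ξ
    rw [Finset.mul_sum, Finset.sum_mul]
    refine Finset.sum_congr rfl fun l _ => ?_
    rw [← mul_assoc]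
    congr 2
    by_cases hξ : ξ = 0
    · subst hξ
      simp [hμ, mul_comm]
    · rw [if_neg hξ]
      simp only [hμ]
      ring
  simp only [hsum]
  rw [Summable.tsum_finsetSum fun l _ => hl_summable_e ((hM l).summable (hal l)) x]
  calc _ ≤ ∑ l : Fin n, (A * T + A' * T) * S :=
        norm_sum_le_of_le _ fun l _ => (hM l).2 (fun ξ => a ξ l) (hal l) S (hFS l) x
    _ = n * (A + A') * T * S := by
        rw [Finset.sum_const, Finset.card_univ, Fintype.card_fin, nsmul_eq_mul]; ring
    _ ≤ (n * (A + A') + 1) * T * S := by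
        gcongr
        linarith
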